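/- arXiv:1404.0302 — 3 statements merged into one kernel-verified Lean document; each statement's English description precedes it below -/
import Mathlib

section
/- For fixed μ ≥ 3/2 and x > 0, Q_μ(x,y) as a function of y is strictly convex for y > x + μ − 1 and strictly concave for 0 < y < x + μ − 3/2. -/
open Real MeasureTheory Set Filter

/-- Modified Bessel function of the first kind `I_ν(z)` (for positive real argument),
defined by its Maclaurin-type series. -/
noncomputable def besselI (ν z : ℝ) : ℝ :=
  ∑' n : ℕ, (z / 2) ^ (ν + 2 * (n : ℝ)) / ((Nat.factorial n : ℝ) * Real.Gamma (ν + (n : ℝ) + 1))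

/-- Generalized Marcum Q-function. -/
noncomputable def marcumQ (μ x y : ℝ) : ℝ :=
  x ^ ((1 - μ) / 2) *
    ∫ t in Set.Ioi y, t ^ ((μ - 1) / 2) * Real.exp (-t - x) * besselI (μ - 1) (2 * Real.sqrt (x * t))

/-- Complementary generalized Marcum P-function. -/
noncomputable def marcumP (μ x y : ℝ) : ℝ :=
  x ^ ((1 - μ) / 2) *
    ∫ t in Set.Ioc (0 : ℝ) y, t ^ ((μ - 1) / 2) * Real.exp (-t - x) * besselI (μ - 1) (2 * Real.sqrt (x * t))

/-- Entire part of the Bessel series. -/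
noncomputable def besA (ν z : ℝ) : ℝ :=
  ∑' n : ℕ, z ^ n / ((Nat.factorial n : ℝ) * Real.Gamma (ν + (n : ℝ) + 1))

lemma gpos {ν : ℝ} (hν : -1 < ν) (n : ℕ) : 0 < Real.Gamma (ν + (n : ℝ) + 1) := by
  apply Real.Gamma_pos_of_pos
  have : (0:ℝ) ≤ n := Nat.cast_nonneg n
  linarith

lemma gsucc {ν : ℝ} (hν : -1 < ν) (n : ℕ) :
    Real.Gamma (ν + ((n + 1 : ℕ) : ℝ) + 1) = (ν + n + 1) * Real.Gamma (ν + (n : ℝ) + 1) := by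
  have : (0:ℝ) ≤ n := Nat.cast_nonneg n
  rw [← Real.Gamma_add_one (by linarith)]
  congr 1; push_cast; ring

lemma bdd_aux {ν : ℝ} (hν : -1 < ν) {c : ℝ} (hc : 0 < c) :
    ∃ M : ℝ, 0 < M ∧ ∀ n : ℕ, c ^ n / Real.Gamma (ν + (n : ℝ) + 1) ≤ M := by
  have hs : Summable (fun n : ℕ => c ^ n / Real.Gamma (ν + (n : ℝ) + 1)) := by
    apply summable_of_ratio_test_tendsto_lt_one (l := 0) one_pos
    · exact Eventually.of_forall fun n => (div_pos (pow_pos hc n) (gpos hν n)).ne'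
    · have h1 : Tendsto (fun n : ℕ => ν + 1 + (n : ℝ)) atTop atTop :=
        tendsto_atTop_add_const_left _ _ tendsto_natCast_atTop_atTop
      have h2 := h1.const_div_atTop c
      refine h2.congr fun n => ?_
      have hg := gpos hν n
      have : (0:ℝ) ≤ n := Nat.cast_nonneg n
      have h3 : 0 < ν + n + 1 := by linarith
      have h4 : 0 < ν + 1 + n := by linarith
      rw [Real.norm_of_nonneg (div_pos (pow_pos hc _) (gpos hν _)).le,
        Real.norm_of_nonneg (div_pos (pow_pos hc _) (gpos hν _)).le, gsucc hν]
      field_simp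
      ring
  obtain ⟨M, hM⟩ := hs.tendsto_atTop_zero.bddAbove_range
  refine ⟨max M 1, by positivity, fun n => le_max_of_le_left (hM ⟨n, rfl⟩)⟩

lemma summ_aux {ν : ℝ} (hν : -1 < ν) (z : ℝ) :
    Summable (fun n : ℕ => z ^ n / ((Nat.factorial n : ℝ) * Real.Gamma (ν + (n : ℝ) + 1))) := by
  obtain ⟨M, hM, hb⟩ := bdd_aux hν one_pos
  refine Summable.of_norm_bounded ((Real.summable_pow_div_factorial |z|).mul_right M) fun n => ?_
  have hg := gpos hν n
  have h := hb n
  rw [norm_div, norm_pow, Real.norm_eq_abs, Real.norm_of_nonneg (by positivity), ← div_div,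
    div_eq_mul_one_div _ (Real.Gamma _)]
  rw [one_pow] at h
  gcongr

lemma besA_pos {ν : ℝ} (hν : -1 < ν) {z : ℝ} (hz : 0 ≤ z) : 0 < besA ν z := by
  refine (summ_aux hν z).tsum_pos (fun n => ?_) 0 ?_
  · have hg := gpos hν n
    positivity
  · have hg := gpos hν 0
    have : 0 < Real.Gamma (ν + ((0:ℕ):ℝ) + 1) := hg
    rw [pow_zero]
    positivity

lemma besA_le {ν x : ℝ} (hν : -1 < ν) (hx : 0 < x) :
    ∃ M : ℝ, 0 < M ∧ ∀ t, 0 ≤ t → besA ν (x * t) ≤ M * Real.exp (t / 2) := by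
  obtain ⟨M, hM, hb⟩ := bdd_aux hν (c := 2 * x) (by positivity)
  refine ⟨M, hM, fun t ht => ?_⟩
  have h1 : HasSum (fun n : ℕ => (t/2)^n / (Nat.factorial n : ℝ)) (Real.exp (t/2)) := by
    rw [Real.exp_eq_exp_ℝ]
    exact NormedSpace.expSeries_div_hasSum_exp (t/2)
  refine (summ_aux hν (x*t)).tsum_le_of_sum_le ?_ |>.trans le_rfl
  intro s
  rw [← (h1.mul_left M).tsum_eq]
  refine le_trans (Finset.sum_le_sum fun n _ => ?_)
    ((h1.mul_left M).summable.sum_le_tsum s (fun n _ => by positivity))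
  have hg := gpos hν n
  have := hb n
  calc (x*t)^n / ((Nat.factorial n : ℝ) * Real.Gamma (ν + (n : ℝ) + 1))
      = (2*x)^n / Real.Gamma (ν + (n : ℝ) + 1) * ((t/2)^n / (Nat.factorial n : ℝ)) := by
        rw [div_mul_div_comm, ← mul_pow, mul_comm (Nat.factorial n : ℝ)]
        congr 2; ring
    _ ≤ _ := by gcongr

lemma besA_deriv {ν : ℝ} (hν : -1 < ν) (z : ℝ) : HasDerivAt (besA ν) (besA (ν + 1) z) z := by
  obtain ⟨M, hM, hb⟩ := bdd_aux hν one_pos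
  set R := |z| + 1 with hR
  have hRpos : 0 < R := by positivity
  have hu : Summable (fun n : ℕ => (n : ℝ) * R ^ (n - 1) / (Nat.factorial n : ℝ) * M) := by
    refine Summable.mul_right M ?_
    rw [← summable_nat_add_iff 1]
    refine (Real.summable_pow_div_factorial R).congr fun n => ?_
    rw [Nat.factorial_succ]; push_cast
    have : ((n:ℝ) + 1) ≠ 0 := by positivity
    try rw [Nat.add_sub_cancel]
    field_simp
  have key := hasDerivAt_tsum_of_isPreconnected (𝕜 := ℝ) (t := Metric.ball (0:ℝ) R)
    (g := fun (n : ℕ) z => z ^ n / ((Nat.factorial n : ℝ) * Real.Gamma (ν + (n : ℝ) + 1)))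
    (g' := fun (n : ℕ) z => (n : ℝ) * z ^ (n - 1) / ((Nat.factorial n : ℝ) * Real.Gamma (ν + (n : ℝ) + 1)))
    (y := z) (y₀ := z) hu Metric.isOpen_ball (convex_ball 0 R).isPreconnected
    (fun n y _ => (hasDerivAt_pow n y).div_const _) ?_ (by simp [hR]) (summ_aux hν z) (by simp [hR])
  · have e : besA (ν + 1) z = ∑' n : ℕ, (n : ℝ) * z ^ (n - 1) / ((Nat.factorial n : ℝ) * Real.Gamma (ν + (n : ℝ) + 1)) := by
      have hs : Summable (fun n : ℕ => (n : ℝ) * z ^ (n - 1) / ((Nat.factorial n : ℝ) * Real.Gamma (ν + (n : ℝ) + 1))) := by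
        rw [← summable_nat_add_iff 1]
        refine (summ_aux (ν := ν + 1) (by linarith) z).congr fun n => ?_
        rw [Nat.factorial_succ]; push_cast
        have : ((n:ℝ) + 1) ≠ 0 := by positivity
        try rw [Nat.add_sub_cancel]
        rw [mul_assoc, mul_div_mul_left _ _ this, show ν + 1 + (n:ℝ) + 1 = ν + (n + 1) + 1 by ring]
      rw [hs.tsum_eq_zero_add]
      simp only [Nat.cast_zero, zero_mul, zero_div, zero_add]
      unfold besA
      refine tsum_congr fun n => ?_
      rw [Nat.factorial_succ]; push_cast
      have : ((n:ℝ) + 1) ≠ 0 := by positivity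
      try rw [Nat.add_sub_cancel]
      rw [mul_assoc, mul_div_mul_left _ _ this, show ν + 1 + (n:ℝ) + 1 = ν + (n + 1) + 1 by ring]
    rw [e]; exact key
  · intro n y hy
    have hg := gpos hν n
    have h := hb n
    rw [one_pow] at h
    have hy' : |y| ≤ R := by
      have := mem_ball_zero_iff.1 hy
      rw [Real.norm_eq_abs] at this
      exact this.le
    rw [norm_div, norm_mul, norm_pow, Real.norm_natCast, Real.norm_eq_abs,
      Real.norm_of_nonneg (by positivity), ← div_div,
      div_eq_mul_one_div _ (Real.Gamma _)]
    gcongr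

lemma besA_rec {ν : ℝ} (hν : 0 < ν) (z : ℝ) :
    besA (ν - 1) z = ν * besA ν z + z * besA (ν + 1) z := by
  have h0 := summ_aux (ν := ν - 1) (by linarith) z
  have h1 := summ_aux (ν := ν) (by linarith) z
  have h2 := summ_aux (ν := ν + 1) (by linarith) z
  unfold besA
  rw [h0.tsum_eq_zero_add, h1.tsum_eq_zero_add, mul_add]
  refine (congrArg₂ (· + ·) ?_ ?_).trans (add_assoc _ _ _).symm
  · have := Real.Gamma_add_one hν.ne'
    simp [this]
    field_simp
  · rw [← tsum_mul_left, ← tsum_mul_left, ← Summable.tsum_add]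
    · refine tsum_congr fun n => ?_
      have hg := gpos (ν := ν) (by linarith) n
      have e2 : Real.Gamma (ν + 1 + (n:ℝ) + 1) = (ν + n + 1) * Real.Gamma (ν + (n : ℝ) + 1) := by
        rw [← gsucc (by linarith)]; congr 1; push_cast; ring
      have e1 := gsucc (ν := ν) (by linarith) n
      have e0 : Real.Gamma (ν - 1 + ((n+1:ℕ):ℝ) + 1) = Real.Gamma (ν + (n : ℝ) + 1) := by
        congr 1; push_cast; ring
      have : (0:ℝ) ≤ n := Nat.cast_nonneg n
      have h3 : 0 < ν + n + 1 := by linarith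
      rw [e0, e1, e2, Nat.factorial_succ]
      push_cast
      field_simp
      ring
    · exact ((summable_nat_add_iff 1).2 h1).mul_left ν
    · exact h2.mul_left z

/-- Quadratic form. -/
noncomputable def besW (ν k z : ℝ) : ℝ :=
  besA (ν - 1) z ^ 2 - k * besA (ν - 1) z * besA ν z - z * besA ν z ^ 2

lemma besW_deriv {ν : ℝ} (hν : 0 < ν) (k z : ℝ) : HasDerivAt (besW ν k)
    ((2 * ν - k - 1) * besA ν z ^ 2 - k * besA (ν - 1) z * besA (ν + 1) z) z := by
  have d0 := besA_deriv (ν := ν - 1) (by linarith) z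
  rw [sub_add_cancel] at d0
  have d1 := besA_deriv (ν := ν) (by linarith) z
  have r := besA_rec hν z
  have := ((d0.pow 2).sub ((d0.const_mul k).mul d1)).sub ((hasDerivAt_id z).mul (d1.pow 2))
  refine this.congr_deriv ?_
  simp only [Nat.cast_ofNat, id, Pi.pow_apply]
  rw [r]; ring

lemma besW_mul_deriv {ν : ℝ} (hν : 0 < ν) (k : ℝ) {z : ℝ} (hz : 0 < z) :
    HasDerivAt (fun z => z ^ k * besW ν k z)
    (z ^ (k - 1) * (k * besW ν k z + ((2 * ν - k - 1) * z * besA ν z ^ 2 -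
      k * besA (ν - 1) z * (besA (ν - 1) z - ν * besA ν z)))) z := by
  have := (Real.hasDerivAt_rpow_const (p := k) (Or.inl hz.ne')).mul (besW_deriv hν k z)
  refine this.congr_deriv ?_
  have e : z ^ k = z ^ (k - 1) * z := by
    rw [← Real.rpow_add_one hz.ne']; congr 1; ring
  rw [e, besA_rec hν z]; ring

lemma besW_half_pos {ν : ℝ} (hν : 1 / 2 ≤ ν) {z : ℝ} (hz : 0 < z) :
    0 < besW ν (ν - 1 / 2) z := by
  have hν0 : 0 < ν := by linarith
  have hc : Continuous (besW ν (ν - 1/2)) :=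
    continuous_iff_continuousAt.2 fun z => (besW_deriv hν0 _ z).continuousAt
  have h0 : 0 < besW ν (ν - 1/2) 0 := by
    have hp := besA_pos (ν := ν) (by linarith) le_rfl
    have : besW ν (ν - 1/2) 0 = ν / 2 * besA ν 0 ^ 2 := by
      unfold besW; rw [besA_rec hν0]; ring
    rw [this]; positivity
  have hev : ∀ᶠ w in nhdsWithin (0:ℝ) (Ioi 0), 0 < besW ν (ν - 1/2) w :=
    (hc.continuousAt.eventually (lt_mem_nhds h0)).filter_mono nhdsWithin_le_nhds
  have hev2 : ∀ᶠ w in nhdsWithin (0:ℝ) (Ioi 0), w ∈ Ioo 0 z := Ioo_mem_nhdsGT hz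
  obtain ⟨ε, hε, hε0, hεz⟩ := (hev.and hev2).exists
  have hm : MonotoneOn (fun z => z ^ (ν - 1/2) * besW ν (ν - 1/2) z) (Ici ε) := by
    refine monotoneOn_of_hasDerivWithinAt_nonneg (convex_Ici ε)
      (fun w hw => (besW_mul_deriv hν0 _ (hε0.trans_le hw)).continuousAt.continuousWithinAt)
      (fun w hw => (besW_mul_deriv hν0 _ ?_).hasDerivWithinAt) ?_
    · rw [interior_Ici] at hw; exact hε0.trans hw
    · intro w hw
      rw [interior_Ici] at hw
      have hw0 : 0 < w := hε0.trans hw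
      have p1 := besA_pos (ν := ν) (by linarith) hw0.le
      have p0 := besA_pos (ν := ν - 1) (by linarith) hw0.le
      have hk : 0 ≤ ν - 1/2 := by linarith
      have : (ν - 1/2) * besW ν (ν - 1/2) w + ((2 * ν - (ν - 1/2) - 1) * w * besA ν w ^ 2 -
        (ν - 1/2) * besA (ν - 1) w * (besA (ν - 1) w - ν * besA ν w))
        = (ν - 1/2) * (besA (ν-1) w * besA ν w) / 2 := by unfold besW; ring
      rw [this]; positivity
  have := hm (self_mem_Ici) hεz.le hεz.le
  have h3 : 0 < z ^ (ν - 1/2) * besW ν (ν - 1/2) z :=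
    lt_of_lt_of_le (mul_pos (Real.rpow_pos_of_pos hε0 _) hε) this
  exact (mul_pos_iff_of_pos_left (Real.rpow_pos_of_pos hz _)).1 h3

lemma besW_neg {ν : ℝ} (hν : 0 < ν) {z : ℝ} (hz : 0 < z) : besW ν ν z < 0 := by
  have hm : StrictAntiOn (fun z => z ^ ν * besW ν ν z) (Ici 0) := by
    refine strictAntiOn_of_deriv_neg (convex_Ici 0) ?_ ?_
    · have hc : Continuous (besW ν ν) :=
        continuous_iff_continuousAt.2 fun z => (besW_deriv hν _ z).continuousAt
      exact ((Real.continuous_rpow_const hν.le).mul hc).continuousOn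
    · intro w hw
      rw [interior_Ici] at hw
      have hw0 : 0 < w := hw
      rw [(besW_mul_deriv hν ν hw0).deriv]
      have p1 := besA_pos (ν := ν) (by linarith) hw0.le
      have : ν * besW ν ν w + ((2 * ν - ν - 1) * w * besA ν w ^ 2 -
        ν * besA (ν - 1) w * (besA (ν - 1) w - ν * besA ν w)) = - (w * besA ν w ^ 2) := by
        unfold besW; ring
      rw [this]
      have := Real.rpow_pos_of_pos hw0 (ν - 1)
      have h2 : 0 < w * besA ν w ^ 2 := by positivity
      nlinarith [mul_pos this h2]
  have := hm (self_mem_Ici) hz.le hz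
  simp only [Real.zero_rpow hν.ne', zero_mul] at this
  exact (pos_iff_neg_of_mul_neg this).1 (Real.rpow_pos_of_pos hz _)

lemma ratio_upper {ν x y : ℝ} (hν : 0 < ν) (hx : 0 < x) (hy : x + ν < y) :
    besA (ν - 1) (x * y) < y * besA ν (x * y) := by
  have hy0 : 0 < y := by linarith
  have hz : 0 < x * y := by positivity
  have p1 := besA_pos (ν := ν) (by linarith) hz.le
  have hW := besW_neg hν hz
  unfold besW at hW
  by_contra! h
  set a := besA (ν - 1) (x * y)
  set b := besA ν (x * y)
  have h1 : 0 < y - ν := by linarith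
  have h2 : (y - ν) * b ≤ a - ν * b := by linarith
  have h3 : y * b * ((y - ν) * b) ≤ a * (a - ν * b) := by
    have : 0 < y * b := by positivity
    have : 0 < (y - ν) * b := by positivity
    gcongr
    linarith
  have h4 : 0 < y * b * b * (y - ν - x) := by
    have : 0 < y - ν - x := by linarith
    positivity
  nlinarith

lemma ratio_lower {ν x y : ℝ} (hν : 1 / 2 ≤ ν) (hx : 0 < x) (hy0 : 0 < y) (hy : y < x + ν - 1 / 2) :
    y * besA ν (x * y) < besA (ν - 1) (x * y) := by
  have hz : 0 < x * y := by positivity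
  have p1 := besA_pos (ν := ν) (by linarith) hz.le
  have p0 := besA_pos (ν := ν - 1) (by linarith) hz.le
  have hW := besW_half_pos hν hz
  unfold besW at hW
  by_contra! h
  set a := besA (ν - 1) (x * y)
  set b := besA ν (x * y)
  obtain ⟨k, hk⟩ : ∃ k, k = ν - 1/2 := ⟨_, rfl⟩
  rw [← hk] at hW
  have h1 : a * a ≤ a * (y * b) := by gcongr
  have h2 : 0 < y * b * b := by positivity
  rcases le_total k y with h3 | h3
  · have h4 : (y - k) * b * a ≤ (y - k) * b * (y * b) := by
      have : 0 ≤ y - k := by linarith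
      gcongr
    have h5 : 0 < (x + k - y) * (y * b * b) := mul_pos (by linarith) h2
    nlinarith
  · have h4 : 0 ≤ (k - y) * (a * b) := mul_nonneg (by linarith) (by positivity)
    have h5 : 0 < x * (y * b * b) := mul_pos hx h2
    nlinarith

/-- Density up to a constant. -/
noncomputable def dens (ν x t : ℝ) : ℝ := t ^ ν * Real.exp (-t) * besA ν (x * t)

lemma dens_deriv {ν x t : ℝ} (hν : 0 < ν) (ht : 0 < t) : HasDerivAt (dens ν x)
    (t ^ (ν - 1) * Real.exp (-t) * (besA (ν - 1) (x * t) - t * besA ν (x * t))) t := by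
  have d1 := (besA_deriv (ν := ν) (by linarith) (x * t)).comp t ((hasDerivAt_id t).const_mul x)
  have d2 := (Real.hasDerivAt_rpow_const (p := ν) (Or.inl ht.ne')).mul ((hasDerivAt_id t).neg.exp)
  have := d2.mul d1
  refine this.congr_deriv ?_
  have e : t ^ ν = t ^ (ν - 1) * t := by
    rw [← Real.rpow_add_one ht.ne']; congr 1; ring
  simp only [id, Function.comp, Pi.mul_apply, Pi.neg_apply]
  rw [e, besA_rec hν]; ring

lemma dens_integrable {ν x : ℝ} (hν : 0 < ν) (hx : 0 < x) : IntegrableOn (dens ν x) (Ioi 0) := by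
  obtain ⟨M, hM, hb⟩ := besA_le (ν := ν) (by linarith) hx
  have h1 := (integrableOn_rpow_mul_exp_neg_mul_rpow (p := 1) (s := ν) (b := 1/2) (by linarith)
    one_pos (by norm_num)).const_mul M
  refine Integrable.mono' h1 ?_ ?_
  · refine ContinuousOn.aestronglyMeasurable (fun t ht => ?_) measurableSet_Ioi
    exact (dens_deriv hν ht).continuousAt.continuousWithinAt
  · refine (ae_restrict_iff' measurableSet_Ioi).2 (Eventually.of_forall fun t ht => ?_)
    have ht0 : 0 < t := ht
    have p1 := besA_pos (ν := ν) (by linarith) (z := x * t) (by positivity)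
    unfold dens
    rw [Real.norm_of_nonneg (by positivity), Real.rpow_one]
    calc t ^ ν * Real.exp (-t) * besA ν (x * t) ≤ t ^ ν * Real.exp (-t) * (M * Real.exp (t/2)) := by
          gcongr; exact hb t ht0.le
      _ = M * (t ^ ν * (Real.exp (-t) * Real.exp (t/2))) := by ring
      _ = _ := by rw [← Real.exp_add]; congr 3; ring

lemma bessel_eq {ν x t : ℝ} (hx : 0 < x) (ht : 0 < t) :
    besselI ν (2 * Real.sqrt (x * t)) = x ^ (ν / 2) * t ^ (ν / 2) * besA ν (x * t) := by
  have hz : 0 < x * t := by positivity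
  unfold besselI besA
  rw [← tsum_mul_left]
  refine tsum_congr fun n => ?_
  rw [mul_div_cancel_left₀ _ two_ne_zero, Real.sqrt_eq_rpow, ← Real.rpow_mul hz.le,
    show 1 / 2 * (ν + 2 * (n : ℝ)) = ν / 2 + n by ring, Real.rpow_add hz, Real.rpow_natCast,
    Real.mul_rpow hx.le ht.le, mul_div_assoc]

lemma marcumQ_eq {μ x y : ℝ} (hx : 0 < x) (hy : 0 < y) :
    marcumQ μ x y = Real.exp (-x) * ∫ t in Ioi y, dens (μ - 1) x t := by
  unfold marcumQ
  rw [← integral_const_mul, ← integral_const_mul]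
  refine setIntegral_congr_fun measurableSet_Ioi fun t ht => ?_
  have ht0 : 0 < t := hy.trans ht
  simp only [dens]
  rw [bessel_eq hx ht0, sub_eq_add_neg (-t) x, Real.exp_add]
  have e1 : x ^ ((1 - μ) / 2) * x ^ ((μ - 1) / 2) = 1 := by
    rw [← Real.rpow_add hx, show (1 - μ) / 2 + (μ - 1) / 2 = 0 by ring, Real.rpow_zero]
  have e2 : t ^ ((μ - 1) / 2) * t ^ ((μ - 1) / 2) = t ^ (μ - 1) := by
    rw [← Real.rpow_add ht0]; congr 1; ring
  rw [← e2]
  linear_combination (t ^ ((μ - 1) / 2) * t ^ ((μ - 1) / 2) * Real.exp (-t) * Real.exp (-x) *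
    besA (μ - 1) (x * t)) * e1

lemma marcumQ_deriv {μ x y : ℝ} (hμ : 1 < μ) (hx : 0 < x) (hy : 0 < y) :
    HasDerivAt (fun y => marcumQ μ x y) (- (Real.exp (-x) * dens (μ - 1) x y)) y := by
  have hν : 0 < μ - 1 := by linarith
  have hI := dens_integrable hν hx
  have hc : ContinuousOn (dens (μ - 1) x) (Ioi 0) :=
    fun t ht => (dens_deriv hν ht).continuousAt.continuousWithinAt
  have h1 : HasDerivAt (fun u => ∫ t in (0:ℝ)..u, dens (μ - 1) x t) (dens (μ - 1) x y) y := by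
    refine intervalIntegral.integral_hasDerivAt_right ?_ ?_ (dens_deriv hν hy).continuousAt
    · rw [intervalIntegrable_iff_integrableOn_Ioc_of_le hy.le]
      exact hI.mono_set Ioc_subset_Ioi_self
    · exact hc.stronglyMeasurableAtFilter isOpen_Ioi y hy
  have h2 := ((h1.const_sub (∫ t in Ioi (0:ℝ), dens (μ - 1) x t)).const_mul (Real.exp (-x)))
  rw [mul_neg] at h2
  refine h2.congr_of_eventuallyEq ?_
  filter_upwards [lt_mem_nhds hy] with u hu
  rw [marcumQ_eq hx hu, ← intervalIntegral.integral_Ioi_sub_Ioi hI hu.le]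
  ring

theorem marcumQ_convexity_y (μ x : ℝ) (hμ : 3 / 2 ≤ μ) (hx : 0 < x) :
    StrictConvexOn ℝ (Set.Ioi (x + μ - 1)) (fun y => marcumQ μ x y) ∧
      StrictConcaveOn ℝ (Set.Ioo 0 (x + μ - 3 / 2)) (fun y => marcumQ μ x y) := by
  have hμ1 : 1 < μ := by linarith
  have hν : 0 < μ - 1 := by linarith
  have hex := Real.exp_pos (-x)
  constructor
  · have hpos : ∀ y ∈ Ioi (x + μ - 1), 0 < y := fun y hy => by
      have : x + μ - 1 < y := hy
      linarith
    refine StrictMonoOn.strictConvexOn_of_deriv (convex_Ioi _)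
      (fun y hy => (marcumQ_deriv hμ1 hx (hpos y hy)).continuousAt.continuousWithinAt) ?_
    rw [interior_Ioi]
    have hm : StrictAntiOn (dens (μ - 1) x) (Ioi (x + μ - 1)) := by
      refine strictAntiOn_of_deriv_neg (convex_Ioi _)
        (fun y hy => (dens_deriv hν (hpos y hy)).continuousAt.continuousWithinAt) ?_
      rw [interior_Ioi]
      intro y hy
      have hy0 := hpos y hy
      have hy' : x + μ - 1 < y := hy
      rw [(dens_deriv hν hy0).deriv]
      have := ratio_upper hν hx (y := y) (by linarith)
      exact mul_neg_of_pos_of_neg (by positivity) (by linarith)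
    intro a ha b hb hab
    rw [(marcumQ_deriv hμ1 hx (hpos a ha)).deriv, (marcumQ_deriv hμ1 hx (hpos b hb)).deriv]
    exact neg_lt_neg (mul_lt_mul_of_pos_left (hm ha hb hab) hex)
  · refine StrictAntiOn.strictConcaveOn_of_deriv (convex_Ioo _ _)
      (fun y hy => (marcumQ_deriv hμ1 hx hy.1).continuousAt.continuousWithinAt) ?_
    rw [interior_Ioo]
    have hm : StrictMonoOn (dens (μ - 1) x) (Ioo 0 (x + μ - 3 / 2)) := by
      refine strictMonoOn_of_deriv_pos (convex_Ioo _ _)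
        (fun y hy => (dens_deriv hν hy.1).continuousAt.continuousWithinAt) ?_
      rw [interior_Ioo]
      intro y hy
      have hy0 := hy.1
      have hy' := hy.2
      rw [(dens_deriv hν hy0).deriv]
      have := ratio_lower (ν := μ - 1) (by linarith) hx hy0 (by linarith)
      exact mul_pos (by positivity) (by linarith)
    intro a ha b hb hab
    rw [(marcumQ_deriv hμ1 hx ha.1).deriv, (marcumQ_deriv hμ1 hx hb.1).deriv]
    exact neg_lt_neg (mul_lt_mul_of_pos_left (hm ha hb hab) hex)
end

section
/- For y > 1/2, the solution x of the equation ½ζ² = x + y − √(1+4xy) + ln((1+√(1+4xy))/(2y)) with sign(ζ) = sign(y − x − 1) has the expansion x = y − 1 + a₁(y)ζ + a₂(y)ζ² + O(ζ³) as ζ → 0, with a₁(y) = −√(2y−1) and a₂(y) = (3y−1)/(3(2y−1)). -/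
open Real Set Filter Asymptotics

lemma log_aux (t : ℝ) (ht : |t| ≤ 1 / 4) :
    |Real.log (1 + t) - (t - t ^ 2 / 2 + t ^ 3 / 3)| ≤ 2 * t ^ 4 := by
  have h := Real.abs_log_sub_add_sum_range_le (x := -t) (by rw [abs_neg]; linarith) 3
  simp only [Finset.sum_range_succ, Finset.sum_range_zero, abs_neg, sub_neg_eq_add] at h
  have h2 : |t| ^ (3 + 1) / (1 - |t|) ≤ 2 * t ^ 4 := by
    rw [div_le_iff₀ (by linarith)]
    have h4 : |t| ^ 4 = t ^ 4 := by
      rw [show |t| ^ 4 = (|t| ^ 2) ^ 2 by ring, sq_abs]; ring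
    norm_num
    rw [h4]
    have : 0 ≤ t ^ 4 := by positivity
    nlinarith
  refine le_trans (le_of_eq ?_) (h.trans h2)
  congr 1
  push_cast
  ring

/-- Lower bound for the phase function. -/
lemma phase_lower (m t e : ℝ) (h1 : |t| ≤ 1 / 4) (h2 : |t| ≤ m / 4)
    (he : |e| ≤ 2 * t ^ 4) : m / 4 * t ^ 2 ≤ m / 2 * t ^ 2 + t ^ 3 / 3 + e := by
  have he' := (abs_le.1 he).1
  have ht := (abs_le.1 h2).1
  have h3 : t ^ 4 ≤ t ^ 2 * (m / 16) := by
    have hm : t ^ 2 ≤ m / 16 := by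
      rw [← sq_abs]; nlinarith [abs_nonneg t]
    nlinarith [mul_le_mul_of_nonneg_left hm (sq_nonneg t)]
  have h5 : -(m / 4) * t ^ 2 ≤ t ^ 3 := by
    nlinarith [mul_le_mul_of_nonneg_right ht (sq_nonneg t)]
  have h6 : 0 ≤ m * t ^ 2 := mul_nonneg (by linarith [abs_nonneg t]) (sq_nonneg t)
  nlinarith

lemma rem_bound (m c t e z : ℝ) (hc : 0 < c) (hm : c ^ 2 = m) (h2 : |t| ≤ m / 4)
    (he : |e| ≤ 2 * t ^ 4) (hz : z ^ 2 / 2 = m / 2 * t ^ 2 + t ^ 3 / 3 + e)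
    (hs : z * t ≤ 0) :
    c * |z + c * t + t ^ 2 / (3 * c)| ≤ (8 + 2 / (9 * m)) * |t| ^ 3 := by
  have hm0 : 0 < m := hm ▸ pow_pos hc 2
  rcases eq_or_ne t 0 with rfl | ht0
  · have he0 : e = 0 := by simpa using he
    have : z = 0 := by
      rw [he0] at hz
      have : z ^ 2 = 0 := by linarith
      exact pow_eq_zero_iff (two_ne_zero) |>.1 this
    simp [this]
  have htp : 0 < |t| := abs_pos.2 ht0
  set r := z + c * t + t ^ 2 / (3 * c) with hr
  set w := z - c * t - t ^ 2 / (3 * c) with hw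
  have hrw : r * w = 2 * e - t ^ 4 / (9 * m) := by
    have : r * w = z ^ 2 - c ^ 2 * t ^ 2 - 2 * t ^ 3 / 3 - t ^ 4 / (9 * c ^ 2) := by
      rw [hr, hw]; field_simp; ring
    rw [this, hm]; linarith
  have hwt : c / 2 * t ^ 2 ≤ -(w * t) := by
    have h5 : -(m / 4) * t ^ 2 ≤ t ^ 3 := by
      nlinarith [mul_le_mul_of_nonneg_right (abs_le.1 h2).1 (sq_nonneg t)]
    have h6 : -(c / 2) * t ^ 2 ≤ t ^ 3 / (3 * c) := by
      rw [le_div_iff₀ (by positivity)]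
      have : -(c / 2) * t ^ 2 * (3 * c) = -(3 / 2) * m * t ^ 2 := by rw [← hm]; ring
      rw [this]
      nlinarith [mul_nonneg hm0.le (sq_nonneg t)]
    have : -(w * t) = -(z * t) + c * t ^ 2 + t ^ 3 / (3 * c) := by rw [hw]; ring
    rw [this]; nlinarith
  have hwa : c / 2 * |t| ≤ |w| := by
    have : -(w * t) ≤ |w| * |t| := by rw [← abs_mul]; exact neg_le_abs _
    have h7 : c / 2 * |t| * |t| ≤ |w| * |t| := by
      rw [mul_assoc, ← sq, sq_abs]; linarith
    exact le_of_mul_le_mul_right h7 htp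
  have habs : |r| * |w| ≤ (4 + 1 / (9 * m)) * t ^ 4 := by
    rw [← abs_mul, hrw]
    have hq : 0 ≤ t ^ 4 / (9 * m) := by positivity
    have hq2 : (4 + 1 / (9 * m)) * t ^ 4 = 4 * t ^ 4 + t ^ 4 / (9 * m) := by ring
    rw [hq2, abs_le]
    have := abs_le.1 he
    have h4 : 0 ≤ t ^ 4 := by positivity
    constructor <;> linarith
  have h8 : |r| * (c / 2 * |t|) ≤ |r| * |w| := mul_le_mul_of_nonneg_left hwa (abs_nonneg r)
  have h4 : t ^ 4 = |t| ^ 3 * |t| := by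
    rw [show |t| ^ 3 * |t| = (|t| ^ 2) ^ 2 by ring, sq_abs]; ring
  rw [h4] at habs
  have h9 : (c * |r|) * |t| ≤ ((8 + 2 / (9 * m)) * |t| ^ 3) * |t| := by
    have : (8 + 2 / (9 * m)) * |t| ^ 3 * |t| = 2 * ((4 + 1 / (9 * m)) * (|t| ^ 3 * |t|)) := by ring
    rw [this]; linarith
  exact le_of_mul_le_mul_right h9 htp

theorem inversion_expansion_x (y : ℝ) (hy : 1 / 2 < y) :
    ∃ X : ℝ → ℝ,
      (∀ᶠ ζ in nhds (0 : ℝ),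
        (1 / 2) * ζ ^ 2 =
            X ζ + y - Real.sqrt (1 + 4 * X ζ * y) +
              Real.log ((1 + Real.sqrt (1 + 4 * X ζ * y)) / (2 * y)) ∧
          Real.sign ζ = Real.sign (y - X ζ - 1)) ∧
      (fun ζ : ℝ =>
          X ζ - (y - 1 + (-Real.sqrt (2 * y - 1)) * ζ + (3 * y - 1) / (3 * (2 * y - 1)) * ζ ^ 2))
        =O[nhds 0] fun ζ : ℝ => ζ ^ 3 := by
  obtain ⟨m, hm⟩ : ∃ m, m = 2 * y - 1 := ⟨_, rfl⟩
  have hm0 : 0 < m := by linarith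
  have hy0 : 0 < y := by linarith
  rw [← hm]
  set c := Real.sqrt m with hc
  have hc0 : 0 < c := Real.sqrt_pos.2 hm0
  have hcm : c ^ 2 = m := Real.sq_sqrt hm0.le
  obtain ⟨δ, hδ0, hδ1, hδ2, hδ3⟩ : ∃ δ : ℝ, 0 < δ ∧ δ ≤ 1 / 4 ∧ δ ≤ m / 4 ∧ δ ≤ m / (4 * y) :=
    ⟨min (1 / 4) (min (m / 4) (m / (4 * y))), by positivity, min_le_left _ _,
      (min_le_right _ _).trans (min_le_left _ _), (min_le_right _ _).trans (min_le_right _ _)⟩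
  rw [le_div_iff₀ (by positivity)] at hδ3
  obtain ⟨F, hF⟩ : ∃ F : ℝ → ℝ, F = fun t => y * t ^ 2 - t + Real.log (1 + t) := ⟨_, rfl⟩
  have hFe : ∀ t, |t| ≤ δ → ∃ e, |e| ≤ 2 * t ^ 4 ∧ F t = m / 2 * t ^ 2 + t ^ 3 / 3 + e := by
    intro t ht
    refine ⟨_, log_aux t (ht.trans hδ1), ?_⟩
    rw [hF, hm]; ring
  have hFl : ∀ t, |t| ≤ δ → m / 4 * t ^ 2 ≤ F t := by
    intro t ht
    obtain ⟨e, he, h⟩ := hFe t ht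
    rw [h]
    exact phase_lower m t e (ht.trans hδ1) (ht.trans hδ2) he
  have hF0 : F 0 = 0 := by simp [hF]
  have hFc : ContinuousOn F (Icc (-δ) δ) := by
    rw [hF]
    refine ContinuousOn.add (by fun_prop) (ContinuousOn.log (by fun_prop) ?_)
    intro t ht
    have := ht.1
    intro h
    linarith
  have key : ∀ z : ℝ, ∃ t, z ^ 2 / 2 ≤ m / 4 * δ ^ 2 → (|t| ≤ δ ∧ F t = z ^ 2 / 2 ∧ z * t ≤ 0) := by
    intro z
    by_cases hz : z ^ 2 / 2 ≤ m / 4 * δ ^ 2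
    · rcases le_total z 0 with h0 | h0
      · have := intermediate_value_Icc hδ0.le (hFc.mono (Icc_subset_Icc_left (by linarith)))
        have hmem : z ^ 2 / 2 ∈ Icc (F 0) (F δ) := by
          refine ⟨by rw [hF0]; positivity, hz.trans (hFl δ (by rw [abs_of_pos hδ0]))⟩
        obtain ⟨t, ht, hFt⟩ := this hmem
        refine ⟨t, fun _ => ⟨abs_le.2 ⟨by linarith [ht.1], ht.2⟩, hFt,
          mul_nonpos_of_nonpos_of_nonneg h0 ht.1⟩⟩
      · have := intermediate_value_Icc' (show -δ ≤ 0 by linarith)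
          (hFc.mono (Icc_subset_Icc_right (by linarith)))
        have hmem : z ^ 2 / 2 ∈ Icc (F 0) (F (-δ)) := by
          refine ⟨by rw [hF0]; positivity, hz.trans ?_⟩
          have := hFl (-δ) (by rw [abs_neg, abs_of_pos hδ0])
          simpa using this
        obtain ⟨t, ht, hFt⟩ := this hmem
        refine ⟨t, fun _ => ⟨abs_le.2 ⟨ht.1, by linarith [ht.2]⟩, hFt,
          mul_nonpos_of_nonneg_of_nonpos h0 ht.2⟩⟩
    · exact ⟨0, fun h => absurd h hz⟩
  choose T hT using key
  have hev : ∀ᶠ z : ℝ in nhds 0, z ^ 2 / 2 ≤ m / 4 * δ ^ 2 := by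
    have hcont : ContinuousAt (fun z : ℝ => z ^ 2 / 2) 0 := by fun_prop
    have : ∀ᶠ z : ℝ in nhds 0, z ^ 2 / 2 < m / 4 * δ ^ 2 :=
      hcont.eventually_lt continuousAt_const (by simp; positivity)
    exact this.mono fun _ h => h.le
  refine ⟨fun z => y - 1 + m * T z + y * T z ^ 2, ?_, ?_⟩
  · filter_upwards [hev] with z hz
    obtain ⟨h1, h2, h3⟩ := hT z hz
    have hlow := hFl _ h1
    set t := T z with ht
    have hyt : |y * t| ≤ m / 4 := by
      rw [abs_mul, abs_of_pos hy0]; nlinarith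
    have hyt' := abs_le.1 hyt
    have hsq : Real.sqrt (1 + 4 * (y - 1 + m * t + y * t ^ 2) * y) = 2 * y * (1 + t) - 1 := by
      rw [show 1 + 4 * (y - 1 + m * t + y * t ^ 2) * y = (2 * y * (1 + t) - 1) ^ 2 by
        rw [hm]; ring]
      exact Real.sqrt_sq (by linarith)
    constructor
    · rw [hsq, show (1 + (2 * y * (1 + t) - 1)) / (2 * y) = 1 + t by field_simp; ring]
      have : (1 / 2) * z ^ 2 = F t := by rw [h2]; ring
      rw [this, hF, hm]; ring
    · have hpos : 0 < m + y * t := by linarith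
      rw [show y - (y - 1 + m * t + y * t ^ 2) - 1 = (m + y * t) * (-t) by ring]
      rcases lt_trichotomy t 0 with h | h | h
      · have hz0 : z ≠ 0 := by
          rintro rfl
          have : 0 < m / 4 * t ^ 2 := by have := h.ne; positivity
          rw [h2] at hlow; norm_num at hlow; linarith
        have : 0 ≤ z := by by_contra hh; push Not at hh; nlinarith [mul_pos_of_neg_of_neg hh h]
        rw [Real.sign_of_pos (lt_of_le_of_ne this hz0.symm),
          Real.sign_of_pos (mul_pos hpos (by linarith))]
      · rw [h, hF0] at h2
        have : z = 0 := by
          have : z ^ 2 = 0 := by linarith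
          exact pow_eq_zero_iff (two_ne_zero) |>.1 this
        rw [this, h]; simp
      · have hz0 : z ≠ 0 := by
          rintro rfl
          have : 0 < m / 4 * t ^ 2 := by positivity
          rw [h2] at hlow; norm_num at hlow; linarith
        have : z ≤ 0 := by by_contra hh; push Not at hh; nlinarith [mul_pos hh h]
        rw [Real.sign_of_neg (lt_of_le_of_ne this hz0),
          Real.sign_of_neg (mul_neg_of_pos_of_neg hpos (by linarith))]
  · obtain ⟨a, ha⟩ : ∃ a, a = (3 * y - 1) / (3 * m) := ⟨_, rfl⟩
    rw [← ha]
    have ham : a * m = y - 1 / 3 := by rw [ha]; field_simp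
    refine IsBigO.trans (g := fun z => T z ^ 3) (IsBigO.of_bound (8 + 2 / (9 * m) + |a| * 2) ?_)
      (IsBigO.pow (IsBigO.of_bound (2 / c) ?_) 3)
    · filter_upwards [hev] with z hz
      obtain ⟨h1, h2, h3⟩ := hT z hz
      obtain ⟨e, he, hFt⟩ := hFe _ h1
      set t := T z with ht
      have hr := rem_bound m c t e z hc0 hcm (h1.trans hδ2) he (by rw [← h2, hFt]) h3
      have hzz : z ^ 2 = m * t ^ 2 + 2 * t ^ 3 / 3 + 2 * e := by linarith
      have heq : y - 1 + m * t + y * t ^ 2 - (y - 1 + -c * z + a * z ^ 2)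
          = c * (z + c * t + t ^ 2 / (3 * c)) - a * (2 * t ^ 3 / 3 + 2 * e) := by
        have h : c * (z + c * t + t ^ 2 / (3 * c)) = c * z + c ^ 2 * t + t ^ 2 / 3 := by
          field_simp
        rw [h, hcm, hzz]
        linear_combination (-t ^ 2) * ham
      rw [heq, Real.norm_eq_abs, Real.norm_eq_abs, abs_pow]
      refine (abs_sub _ _).trans ?_
      rw [abs_mul, abs_mul, abs_of_pos hc0, add_mul, mul_assoc |a|]
      refine add_le_add hr (mul_le_mul_of_nonneg_left ?_ (abs_nonneg a))
      have h4 : t ^ 4 ≤ |t| ^ 3 * (1 / 4) := by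
        rw [show t ^ 4 = |t| ^ 3 * |t| by
          rw [show |t| ^ 3 * |t| = (|t| ^ 2) ^ 2 by ring, sq_abs]; ring]
        exact mul_le_mul_of_nonneg_left (h1.trans hδ1) (by positivity)
      have h5 : |t ^ 3| = |t| ^ 3 := abs_pow _ _
      have h6 := abs_le.1 h5.le
      have h7 := abs_le.1 he
      rw [abs_le]
      constructor <;> linarith [show 0 ≤ |t| ^ 3 by positivity]
    · filter_upwards [hev] with z hz
      obtain ⟨h1, h2, h3⟩ := hT z hz
      have hlow := hFl _ h1
      rw [h2] at hlow
      rw [Real.norm_eq_abs, Real.norm_eq_abs]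
      refine abs_le_of_sq_le_sq' ?_ (by positivity) |> abs_le.2 |> fun h => h
      rw [mul_pow, div_pow, sq_abs, hcm]
      rw [div_mul_eq_mul_div, le_div_iff₀ hm0]
      nlinarith [sq_nonneg z]
end

section
/- For x > −1/2, the solution y of the equation ½ζ² = x + y − √(1+4xy) + ln((1+√(1+4xy))/(2y)) with sign(ζ) = sign(y − x − 1) has the expansion y = x + 1 + b₁(x)ζ + b₂(x)ζ² + O(ζ³) as ζ → 0, where b₁(x) = √(2x+1) and b₂(x) = (3x+1)/(3(2x+1)). -/
open Real Set Filter Asymptotics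

/-- Abstract inversion: a function with a quartic-accurate Taylor bound can be inverted. -/
theorem aux_invert (F : ℝ → ℝ) (b c D C δ : ℝ) (hb : 0 < b) (hδ : 0 < δ)
    (hD : D = -c / b ^ 4) (hF : ContinuousOn F (Icc (-δ) δ))
    (hT : ∀ u, |u| ≤ δ → |F u - (u ^ 2 / (2 * b ^ 2) + D * u ^ 3)| ≤ C * u ^ 4) :
    ∃ K : ℝ, ∀ᶠ ζ in nhds (0 : ℝ), ∃ k : ℝ, |k| ≤ K ∧
      F (ζ * (b + c * ζ + k * ζ ^ 2)) = (1 / 2) * ζ ^ 2 ∧ 0 < b + c * ζ + k * ζ ^ 2 := by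
  set M : ℝ := |c ^ 2 / (2 * b ^ 2) + 3 * D * b ^ 2 * c| + |C| * b ^ 4 + 1 with hM
  have hM0 : 0 < M := by positivity
  set K : ℝ := b * M with hK
  have hK0 : 0 < K := by positivity
  let Φ : ℝ → ℝ → ℝ := fun k ζ => k / b + (c + k * ζ) ^ 2 / (2 * b ^ 2) +
    D * (c + k * ζ) * (3 * b ^ 2 + 3 * b * (ζ * (c + k * ζ)) + (ζ * (c + k * ζ)) ^ 2)
  have key : ∀ k ζ : ℝ, (ζ * (b + c * ζ + k * ζ ^ 2)) ^ 2 / (2 * b ^ 2) +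
      D * (ζ * (b + c * ζ + k * ζ ^ 2)) ^ 3 = (1 / 2) * ζ ^ 2 + ζ ^ 4 * Φ k ζ := by
    intro k ζ
    simp only [Φ, hD]
    field_simp
    ring
  have e1 : ∀ᶠ ζ in nhds (0 : ℝ), 0 < Φ K ζ - C * (b + c * ζ + K * ζ ^ 2) ^ 4 := by
    have hc : ContinuousAt (fun ζ => Φ K ζ - C * (b + c * ζ + K * ζ ^ 2) ^ 4) 0 := by
      simp only [Φ]; fun_prop
    refine hc.eventually (lt_mem_nhds ?_)
    have h1 : K / b = M := by rw [hK]; field_simp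
    simp only [Φ, h1]
    have := neg_abs_le (c ^ 2 / (2 * b ^ 2) + 3 * D * b ^ 2 * c)
    have h2 : C * b ^ 4 ≤ |C| * b ^ 4 := by gcongr; exact le_abs_self C
    ring_nf at *
    linarith
  have e2 : ∀ᶠ ζ in nhds (0 : ℝ), Φ (-K) ζ + C * (b + c * ζ + (-K) * ζ ^ 2) ^ 4 < 0 := by
    have hc : ContinuousAt (fun ζ => Φ (-K) ζ + C * (b + c * ζ + (-K) * ζ ^ 2) ^ 4) 0 := by
      simp only [Φ]; fun_prop
    refine hc.eventually (gt_mem_nhds ?_)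
    have h1 : (-K) / b = -M := by rw [hK]; field_simp
    simp only [Φ, h1]
    have := le_abs_self (c ^ 2 / (2 * b ^ 2) + 3 * D * b ^ 2 * c)
    have h2 : C * b ^ 4 ≤ |C| * b ^ 4 := by gcongr; exact le_abs_self C
    ring_nf at *
    linarith
  have e3 : ∀ᶠ ζ in nhds (0 : ℝ), |c * ζ| + K * ζ ^ 2 < b := by
    have hc : ContinuousAt (fun ζ : ℝ => |c * ζ| + K * ζ ^ 2) 0 := by fun_prop
    exact hc.eventually (gt_mem_nhds (by simpa using hb))
  have e4 : ∀ᶠ ζ in nhds (0 : ℝ), |ζ| * (2 * b) < δ := by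
    have hc : ContinuousAt (fun ζ : ℝ => |ζ| * (2 * b)) 0 := by fun_prop
    exact hc.eventually (gt_mem_nhds (by simpa using hδ))
  refine ⟨K, ?_⟩
  filter_upwards [e1, e2, e3, e4] with ζ h1 h2 h3 h4
  have hw : ∀ k, |k| ≤ K → 0 < b + c * ζ + k * ζ ^ 2 ∧ b + c * ζ + k * ζ ^ 2 < 2 * b := by
    intro k hk
    have a1 := abs_le.1 hk
    have a2 := neg_abs_le (c * ζ)
    have a3 := le_abs_self (c * ζ)
    have a4 := mul_le_mul_of_nonneg_right a1.1 (sq_nonneg ζ)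
    have a5 := mul_le_mul_of_nonneg_right a1.2 (sq_nonneg ζ)
    constructor <;> linarith
  have hu : ∀ k, |k| ≤ K → |ζ * (b + c * ζ + k * ζ ^ 2)| ≤ δ := by
    intro k hk
    obtain ⟨p, q⟩ := hw k hk
    rw [abs_mul, abs_of_pos p]
    exact (mul_le_mul_of_nonneg_left q.le (abs_nonneg ζ)).trans h4.le
  have hcont : ContinuousOn (fun k => F (ζ * (b + c * ζ + k * ζ ^ 2))) (Icc (-K) K) := by
    refine hF.comp (by fun_prop) ?_
    intro k hk
    exact abs_le.1 (hu k (abs_le.2 hk))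
  have hKK : |K| ≤ K := (abs_of_pos hK0).le
  have hKn : |-K| ≤ K := by rw [abs_neg]; exact hKK
  have z4 : 0 ≤ ζ ^ 4 := by positivity
  have up : (1 / 2) * ζ ^ 2 ≤ F (ζ * (b + c * ζ + K * ζ ^ 2)) := by
    have := (abs_le.1 (hT _ (hu K hKK))).1
    rw [key] at this
    have h5 := mul_nonneg z4 h1.le
    have h6 := mul_pow ζ (b + c * ζ + K * ζ ^ 2) 4
    rw [h6] at this
    linarith
  have lo : F (ζ * (b + c * ζ + (-K) * ζ ^ 2)) ≤ (1 / 2) * ζ ^ 2 := by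
    have := (abs_le.1 (hT _ (hu (-K) hKn))).2
    rw [key] at this
    have h5 := mul_nonneg z4 (neg_pos.2 h2).le
    have h6 := mul_pow ζ (b + c * ζ + (-K) * ζ ^ 2) 4
    rw [h6] at this
    linarith
  obtain ⟨k, hk, hk2⟩ := intermediate_value_Icc (by linarith) hcont ⟨lo, up⟩
  exact ⟨k, abs_le.2 hk, hk2, (hw k (abs_le.2 hk)).1⟩

/-- The Taylor estimate for the phase function around its double zero. -/
theorem aux_taylor (x : ℝ) (hx : -(1 / 2) < x) (F : ℝ → ℝ)
    (hFdef : F = fun u => x + (x + 1 + u) - Real.sqrt (1 + 4 * x * (x + 1 + u)) +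
              Real.log ((1 + Real.sqrt (1 + 4 * x * (x + 1 + u))) / (2 * (x + 1 + u)))) :
    ∃ C δ : ℝ, 0 < δ ∧ ContinuousOn F (Icc (-δ) δ) ∧
    ∀ u, |u| ≤ δ → |F u - (u ^ 2 / (2 * (2 * x + 1)) +
      (-(3 * x + 1) / (3 * (2 * x + 1) ^ 3)) * u ^ 3)| ≤ C * u ^ 4 := by
  obtain ⟨t, ht⟩ : ∃ t, t = 2 * x + 1 := ⟨_, rfl⟩
  have ht0 : 0 < t := by linarith
  have hxt : x = (t - 1) / 2 := by linarith
  let s : ℝ → ℝ := fun u => Real.sqrt (1 + 4 * x * (x + 1 + u))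
  let q : ℝ → ℝ := fun u => t + (t - 1) / t * u - (t - 1) ^ 2 / (2 * t ^ 3) * u ^ 2
  let P : ℝ → ℝ := fun u => (t - 1) ^ 3 / t ^ 4 - (t - 1) ^ 4 / (4 * t ^ 6) * u
  let R : ℝ → ℝ := fun u => ((3 * t - 1) / t ^ 3 - P u / (s u + q u)) / (2 * (x + 1 + u))
  have hs0 : s 0 = t := by
    simp only [s]
    rw [show 1 + 4 * x * (x + 1 + 0) = t ^ 2 by rw [ht]; ring]
    exact Real.sqrt_sq ht0.le
  have hq0 : q 0 = t := by simp [q]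
  have hsc : Continuous s := by simp only [s]; fun_prop
  have hqc : Continuous q := by simp only [q]; fun_prop
  have hPc : Continuous P := by simp only [P]; fun_prop
  have hRc : ContinuousAt R 0 := by
    simp only [R]
    refine ContinuousAt.div (ContinuousAt.sub continuousAt_const
      (hPc.continuousAt.div (hsc.continuousAt.add hqc.continuousAt) ?_)) (by fun_prop) ?_
    · rw [hs0, hq0]; positivity
    · rw [hxt]; ring_nf; positivity
  have E : ∀ᶠ u in nhds (0 : ℝ), |R u| < |R 0| + 1 ∧ 0 < s u ∧ 0 < s u + q u ∧ 0 < x + 1 + u := by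
    refine (hRc.abs.eventually (gt_mem_nhds (by linarith))).and
      ((hsc.continuousAt.eventually (lt_mem_nhds (by rw [hs0]; exact ht0))).and
      (((hsc.add hqc).continuousAt.eventually (lt_mem_nhds ?_)).and
      ((by fun_prop : ContinuousAt (fun u : ℝ => x + 1 + u) 0).eventually (lt_mem_nhds ?_))))
    · simp only [Pi.add_apply, hs0, hq0]; positivity
    · linarith
  obtain ⟨ε, hε, hE⟩ := Metric.eventually_nhds_iff.1 E
  have hE' : ∀ u, |u| ≤ ε / 2 → |R u| < |R 0| + 1 ∧ 0 < s u ∧ 0 < s u + q u ∧ 0 < x + 1 + u := by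
    intro u hu
    apply hE
    rw [Real.dist_eq, sub_zero]; linarith
  let G : ℝ → ℝ := fun u => F u - (u ^ 2 / (2 * (2 * x + 1)) +
      (-(3 * x + 1) / (3 * (2 * x + 1) ^ 3)) * u ^ 3)
  have hFderiv : ∀ u, |u| ≤ ε / 2 → HasDerivAt F (1 - (s u + 1) / (2 * (x + 1 + u))) u := by
    intro u hu
    obtain ⟨-, h1, -, h2⟩ := hE' u hu
    have hpos : 0 < 1 + 4 * x * (x + 1 + u) := Real.sqrt_pos.1 h1
    have hsq : s u ^ 2 = 1 + 4 * x * (x + 1 + u) := Real.sq_sqrt hpos.le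
    have hy : HasDerivAt (fun u : ℝ => x + 1 + u) 1 u := (hasDerivAt_id u).const_add _
    have hin : HasDerivAt (fun u : ℝ => 1 + 4 * x * (x + 1 + u)) (4 * x * 1) u :=
      (hy.const_mul (4 * x)).const_add 1
    have hsd : HasDerivAt s (4 * x * 1 / (2 * s u)) u := hin.sqrt hpos.ne'
    have hl : HasDerivAt (fun u => Real.log ((1 + s u) / (2 * (x + 1 + u)))) _ u :=
      ((hsd.const_add 1).div (hy.const_mul 2) (by positivity)).log (by
        simp only [Pi.div_apply]; positivity)
    have hall := ((hy.const_add x).sub hsd).add hl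
    rw [hFdef]
    refine hall.congr_deriv ?_
    simp only [Pi.div_apply]
    obtain ⟨S, hS⟩ : ∃ S, S = s u := ⟨_, rfl⟩
    obtain ⟨y, hy'⟩ : ∃ y, y = x + 1 + u := ⟨_, rfl⟩
    rw [← hS] at h1 hsq ⊢
    rw [← hy'] at h2 hsq ⊢
    have h3 : 0 < 1 + S := by positivity
    field_simp
    have h4 : 4 * x * y = S ^ 2 - 1 := by linarith
    linear_combination (-S) * h4
  have hGderiv : ∀ u, |u| ≤ ε / 2 → HasDerivAt G (u ^ 3 * R u) u := by
    intro u hu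
    obtain ⟨-, h1, h3, h2⟩ := hE' u hu
    have hpos : 0 < 1 + 4 * x * (x + 1 + u) := Real.sqrt_pos.1 h1
    have hsq : s u ^ 2 = 1 + 4 * x * (x + 1 + u) := Real.sq_sqrt hpos.le
    have hp2 := (hasDerivAt_pow 2 u).div_const (2 * (2 * x + 1))
    have hp3 := (hasDerivAt_pow 3 u).const_mul (-(3 * x + 1) / (3 * (2 * x + 1) ^ 3))
    refine ((hFderiv u hu).sub (hp2.add hp3)).congr_deriv ?_
    have hsq' : s u = q u + u ^ 3 * (P u / (s u + q u)) := by
      have e : (s u - q u) * (s u + q u) = u ^ 3 * P u := by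
        rw [show (s u - q u) * (s u + q u) = s u ^ 2 - q u ^ 2 by ring, hsq, hxt]
        simp only [q, P]
        field_simp
        ring
      have : s u - q u = u ^ 3 * P u / (s u + q u) := by
        rw [eq_div_iff h3.ne', e]
      rw [mul_div_assoc] at this
      linarith
    have hy0 : (t - 1) / 2 + 1 + u ≠ 0 := by rw [← hxt]; exact h2.ne'
    simp only [R]
    generalize P u / (s u + q u) = W at hsq' ⊢
    rw [hsq', ← ht, hxt]
    simp only [q]
    have hy1 : 2 * ((t - 1) / 2 + 1 + u) = t + 1 + 2 * u := by ring
    have hy2 : t + 1 + 2 * u ≠ 0 := by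
      intro h; apply hy0; linarith
    rw [hy1]
    obtain ⟨d, hd⟩ : ∃ d, d = t + 1 + 2 * u := ⟨_, rfl⟩
    rw [← hd] at hy2 ⊢
    push_cast
    field_simp
    rw [hd]
    ring
  refine ⟨|R 0| + 1, ε / 2, by positivity, ?_, ?_⟩
  · intro u hu
    exact (hFderiv u (abs_le.2 hu)).continuousAt.continuousWithinAt
  · intro u hu
    have hG0 : G 0 = 0 := by
      have : F 0 = 0 := by
        have h : F 0 = x + (x + 1 + 0) - s 0 + Real.log ((1 + s 0) / (2 * (x + 1 + 0))) := by
          rw [hFdef]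
        rw [h, hs0, show (1 + t) / (2 * (x + 1 + 0)) = 1 by
          rw [ht, div_eq_one_iff_eq (by linarith)]; ring]
        simp [ht]; ring
      simp [G, this]
    have hb := Convex.norm_image_sub_le_of_norm_hasDerivWithin_le (f := G)
      (f' := fun v => v ^ 3 * R v) (s := Icc (-|u|) |u|) (C := |u| ^ 3 * (|R 0| + 1))
      (x := 0) (y := u)
      (fun v hv => (hGderiv v ((abs_le.2 hv).trans hu)).hasDerivWithinAt)
      (fun v hv => by
        have hv' := abs_le.2 hv
        rw [Real.norm_eq_abs, abs_mul, abs_pow]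
        have := (hE' v (hv'.trans hu)).1.le
        gcongr)
      (convex_Icc _ _) (by simp) (abs_le.1 le_rfl)
    rw [hG0, sub_zero, sub_zero, Real.norm_eq_abs, Real.norm_eq_abs] at hb
    refine hb.trans_eq ?_
    have : u ^ 4 = |u| ^ 4 := (Even.pow_abs (by decide) u).symm
    rw [this]; ring

theorem inversion_expansion_y (x : ℝ) (hx : -(1 / 2) < x) :
    ∃ Y : ℝ → ℝ,
      (∀ᶠ ζ in nhds (0 : ℝ),
        (1 / 2) * ζ ^ 2 =
            x + Y ζ - Real.sqrt (1 + 4 * x * Y ζ) +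
              Real.log ((1 + Real.sqrt (1 + 4 * x * Y ζ)) / (2 * Y ζ)) ∧
          Real.sign ζ = Real.sign (Y ζ - x - 1)) ∧
      (fun ζ : ℝ =>
          Y ζ - (x + 1 + Real.sqrt (2 * x + 1) * ζ + (3 * x + 1) / (3 * (2 * x + 1)) * ζ ^ 2))
        =O[nhds 0] fun ζ : ℝ => ζ ^ 3 := by
  obtain ⟨C, δ, hδ, hc, hT⟩ := aux_taylor x hx _ rfl
  have ht : 0 < 2 * x + 1 := by linarith
  have hb : 0 < Real.sqrt (2 * x + 1) := Real.sqrt_pos.2 ht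
  have hb2 : Real.sqrt (2 * x + 1) ^ 2 = 2 * x + 1 := Real.sq_sqrt ht.le
  have hb4 : Real.sqrt (2 * x + 1) ^ 4 = (2 * x + 1) ^ 2 := by
    rw [show Real.sqrt (2 * x + 1) ^ 4 = (Real.sqrt (2 * x + 1) ^ 2) ^ 2 by ring, hb2]
  obtain ⟨K, hK⟩ := aux_invert _ (Real.sqrt (2 * x + 1)) ((3 * x + 1) / (3 * (2 * x + 1)))
    (-(3 * x + 1) / (3 * (2 * x + 1) ^ 3)) C δ hb hδ (by rw [hb4]; field_simp) hc
    (by rw [hb2]; exact hT)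
  obtain ⟨k, hk⟩ := hK.choice
  refine ⟨fun ζ => x + 1 +
    ζ * (Real.sqrt (2 * x + 1) + (3 * x + 1) / (3 * (2 * x + 1)) * ζ + k ζ * ζ ^ 2), ?_, ?_⟩
  · filter_upwards [hk] with ζ hζ
    obtain ⟨-, h2, h3⟩ := hζ
    refine ⟨h2.symm, ?_⟩
    rw [show ∀ w : ℝ, x + 1 + w - x - 1 = w by intro w; ring]
    rcases lt_trichotomy ζ 0 with h | h | h
    · rw [Real.sign_of_neg h, Real.sign_of_neg (mul_neg_of_neg_of_pos h h3)]
    · simp [h]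
    · rw [Real.sign_of_pos h, Real.sign_of_pos (mul_pos h h3)]
  · refine IsBigO.of_bound K ?_
    filter_upwards [hk] with ζ hζ
    obtain ⟨h1, -, -⟩ := hζ
    rw [show ∀ a b c : ℝ, x + 1 + ζ * (a + b * ζ + c * ζ ^ 2) - (x + 1 + a * ζ + b * ζ ^ 2)
      = c * ζ ^ 3 by intros; ring, norm_mul, Real.norm_eq_abs]
    gcongr
end
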